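/- Let α = K/n and suppose 0 < α < p, 0 < β < 1, β < (p−α)/p, and 0 < δ < p − α/(1−β). Define the real sequence x_0 = 0, x_{k+1} = x_k + (n − x_k)(p − δ) − nα. Then for every integer t ≥ 1 such that x_s ≤ nβ for all 0 ≤ s ≤ t−1, the error chain started at X_0 = 0 satisfies P[X_t > x_t] ≥ (1 − exp(−2n(1−β)δ²))^t. -/

import Mathlib

/-- The probability mass function of a `Binomial(m, p)` random variable at `k`. -/
noncomputable def binomPMF (m : ℕ) (p : ℝ) (k : ℕ) : ℝ :=
  (m.choose k : ℝ) * p ^ k * (1 - p) ^ (m - k)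

/-- One-step transition probability of the error Markov chain on `{0, ..., n}`:
from state `x`, draw `Y ~ Binomial(n − x, p)` and move to `x + Y − min (x + Y) K`. -/
noncomputable def stepProb (n K : ℕ) (p : ℝ) (x y : ℕ) : ℝ :=
  ∑ yv ∈ Finset.range (n - x + 1),
    if x + yv - min (x + yv) K = y then binomPMF (n - x) p yv else 0

/-- `m`-step transition probability of the error Markov chain. -/
noncomputable def iterProb (n K : ℕ) (p : ℝ) : ℕ → ℕ → ℕ → ℝ
  | 0 => fun x y => if x = y then 1 else 0
  | (m + 1) => fun x y =>
      ∑ z ∈ Finset.range (n + 1), stepProb n K p x z * iterProb n K p m z y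

open ProbabilityTheory MeasureTheory in
lemma bern_hoeffding (p l : ℝ) (hp0 : 0 < p) (hp1 : p < 1) :
    p * Real.exp l + (1 - p) ≤ Real.exp (l * p + l ^ 2 / 8) := by
  set μ : Measure ℝ := ENNReal.ofReal p • Measure.dirac 1 + ENNReal.ofReal (1 - p) • Measure.dirac 0
    with hμ
  have hprob : IsProbabilityMeasure μ := by
    constructor
    simp only [hμ, Measure.add_apply, Measure.smul_apply, measure_univ, smul_eq_mul, mul_one]
    rw [← ENNReal.ofReal_add hp0.le (by linarith)]
    simp
  have hint : ∀ f : ℝ → ℝ, ∫ x, f x ∂μ = p * f 1 + (1 - p) * f 0 := by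
    intro f
    have h1 : ∀ a : ℝ, Integrable f (Measure.dirac a) := fun a => by
      exact integrable_dirac (by simp)
    rw [hμ, integral_add_measure ((h1 1).smul_measure (by simp)) ((h1 0).smul_measure (by simp)),
      integral_smul_measure, integral_smul_measure, integral_dirac, integral_dirac]
    simp [ENNReal.toReal_ofReal hp0.le, ENNReal.toReal_ofReal (by linarith : (0:ℝ) ≤ 1 - p)]
  have hae : ∀ᵐ x ∂μ, (fun x : ℝ => x) x ∈ Set.Icc (0:ℝ) 1 := by
    rw [hμ, ae_add_measure_iff]
    constructor
    · apply Measure.ae_smul_measure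
      rw [ae_dirac_eq]
      simp
    · apply Measure.ae_smul_measure
      rw [ae_dirac_eq]
      simp
  have h := (hasSubgaussianMGF_of_mem_Icc (μ := μ) (X := fun x : ℝ => x) aemeasurable_id hae).mgf_le l
  rw [mgf, hint, hint] at h
  have e : p * Real.exp l + (1 - p) = Real.exp (l * p) *
    (p * Real.exp (l * (1 - (p * 1 + (1 - p) * 0))) +
      (1 - p) * Real.exp (l * (0 - (p * 1 + (1 - p) * 0)))) := by
    have e1 : Real.exp (l * (1 - (p * 1 + (1 - p) * 0))) = Real.exp l * Real.exp (- (l * p)) := by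
      rw [← Real.exp_add]; ring_nf
    have e2 : Real.exp (l * (0 - (p * 1 + (1 - p) * 0))) = Real.exp (- (l * p)) := by
      ring_nf
    have e3 : Real.exp (l * p) * Real.exp (-(l * p)) = 1 := by
      rw [← Real.exp_add]; simp
    rw [e1, e2]
    linear_combination (-(p * Real.exp l + (1 - p))) * e3
  rw [e, Real.exp_add]
  refine mul_le_mul_of_nonneg_left (h.trans (Real.exp_le_exp.2 ?_)) (Real.exp_pos _).le
  simp
  apply le_of_eq
  ring

lemma binomPMF_nonneg (m : ℕ) (p : ℝ) (k : ℕ) (hp0 : 0 < p) (hp1 : p < 1) :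
    0 ≤ binomPMF m p k := by
  have : 0 ≤ 1 - p := by linarith
  unfold binomPMF
  positivity

lemma binomPMF_mgf (m : ℕ) (p l : ℝ) :
    ∑ k ∈ Finset.range (m + 1), binomPMF m p k * Real.exp (l * k)
      = (p * Real.exp l + (1 - p)) ^ m := by
  rw [add_pow]
  refine Finset.sum_congr rfl fun k _ => ?_
  rw [binomPMF, mul_pow, ← Real.exp_nat_mul, mul_comm (k : ℝ) l]
  ring

lemma binomPMF_sum (m : ℕ) (p : ℝ) :
    ∑ k ∈ Finset.range (m + 1), binomPMF m p k = 1 := by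
  have := binomPMF_mgf m p 0
  simpa using this

lemma binom_tail (N : ℕ) (p δ a : ℝ) (hp0 : 0 < p) (hp1 : p < 1) (hδ : 0 < δ) :
    ∑ k ∈ Finset.range (N + 1), (if (k : ℝ) ≤ a then binomPMF N p k else 0) ≤
      Real.exp (4 * δ * (a - N * p) + 2 * N * δ ^ 2) := by
  calc _ ≤ ∑ k ∈ Finset.range (N + 1),
        Real.exp (4 * δ * a) * (binomPMF N p k * Real.exp (-(4 * δ) * k)) := by
        refine Finset.sum_le_sum fun k _ => ?_
        have h0 := binomPMF_nonneg N p k hp0 hp1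
        split_ifs with h
        · have : 1 ≤ Real.exp (4 * δ * a) * Real.exp (-(4 * δ) * k) := by
            rw [← Real.exp_add]
            apply Real.one_le_exp
            nlinarith
          nlinarith
        · positivity
    _ = Real.exp (4 * δ * a) * (p * Real.exp (-(4 * δ)) + (1 - p)) ^ N := by
        rw [← Finset.mul_sum, binomPMF_mgf]
    _ ≤ Real.exp (4 * δ * a) * (Real.exp (-(4 * δ) * p + (-(4 * δ)) ^ 2 / 8)) ^ N := by
        have : 0 ≤ 1 - p := by linarith
        gcongr
        exact bern_hoeffding p _ hp0 hp1
    _ = _ := by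
        rw [← Real.exp_nat_mul, ← Real.exp_add]
        congr 1
        ring

lemma stepProb_nonneg (n K : ℕ) (p : ℝ) (x y : ℕ) (hp0 : 0 < p) (hp1 : p < 1) :
    0 ≤ stepProb n K p x y := by
  unfold stepProb
  refine Finset.sum_nonneg fun k _ => ?_
  split_ifs
  · exact binomPMF_nonneg _ _ _ hp0 hp1
  · exact le_rfl

lemma iterProb_nonneg (n K : ℕ) (p : ℝ) (hp0 : 0 < p) (hp1 : p < 1) (m : ℕ) :
    ∀ x y, 0 ≤ iterProb n K p m x y := by
  induction m with
  | zero => intro x y; simp only [iterProb]; split_ifs <;> norm_num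
  | succ m ih =>
    intro x y
    simp only [iterProb]
    exact Finset.sum_nonneg fun z _ => mul_nonneg (stepProb_nonneg n K p x z hp0 hp1) (ih z y)

lemma step_bound (n K : ℕ) (p β δ u v : ℝ) (hp0 : 0 < p) (hp1 : p < 1)
    (hδ0 : 0 < δ) (hu : u ≤ n * β) (hv : v = u + ((n : ℝ) - u) * (p - δ) - K)
    (z : ℕ) (hz : z ≤ n) (huz : u ≤ z) :
    1 - Real.exp (-2 * n * (1 - β) * δ ^ 2) ≤
      ∑ y ∈ Finset.range (n + 1), if v < (y : ℝ) then stepProb n K p z y else 0 := by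
  have key : ∑ y ∈ Finset.range (n + 1), (if v < (y : ℝ) then stepProb n K p z y else 0)
      = ∑ k ∈ Finset.range (n - z + 1),
        if v < ((z + k - min (z + k) K : ℕ) : ℝ) then binomPMF (n - z) p k else 0 := by
    simp only [stepProb, ← Finset.sum_filter]
    rw [Finset.sum_filter]
    simp only [Finset.sum_filter]
    have : ∀ y ∈ Finset.range (n + 1), (if v < (y : ℝ) then ∑ k ∈ Finset.range (n - z + 1),
        (if z + k - min (z + k) K = y then binomPMF (n - z) p k else 0) else 0)
        = ∑ k ∈ Finset.range (n - z + 1), if z + k - min (z + k) K = y then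
          (if v < ((z + k - min (z + k) K : ℕ) : ℝ) then binomPMF (n - z) p k else 0) else 0 := by
      intro y _
      split_ifs with h
      · refine Finset.sum_congr rfl fun k _ => ?_
        by_cases h2 : z + k - min (z + k) K = y
        · rw [if_pos h2, if_pos h2, h2, if_pos h]
        · rw [if_neg h2, if_neg h2]
      · symm
        refine Finset.sum_eq_zero fun k _ => ?_
        by_cases h2 : z + k - min (z + k) K = y
        · rw [if_pos h2, h2, if_neg h]
        · rw [if_neg h2]
    rw [Finset.sum_congr rfl this, Finset.sum_comm]
    refine Finset.sum_congr rfl fun k hk => ?_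
    rw [Finset.sum_ite_eq, if_pos]
    simp only [Finset.mem_range] at hk ⊢
    omega
  rw [key]
  have tail := binom_tail (n - z) p δ (v + K - z) hp0 hp1 hδ0
  have hN : ((n - z : ℕ) : ℝ) = n - z := by push_cast [hz]; ring
  have hexp : Real.exp (4 * δ * ((v + K - z) - (n - z : ℕ) * p) + 2 * (n - z : ℕ) * δ ^ 2) ≤
      Real.exp (-2 * n * (1 - β) * δ ^ 2) := by
    apply Real.exp_le_exp.2
    rw [hN, hv]
    have h1 : 0 ≤ δ * ((z - u) * (1 - p)) :=
      mul_nonneg hδ0.le (mul_nonneg (by linarith) (by linarith))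
    have h2 : 0 ≤ δ ^ 2 * (z - u) := mul_nonneg (by positivity) (by linarith)
    have h3 : 0 ≤ δ ^ 2 * (n * β - u) := mul_nonneg (by positivity) (by linarith)
    nlinarith
  have hsplit : ∑ k ∈ Finset.range (n - z + 1), binomPMF (n - z) p k ≤
      ∑ k ∈ Finset.range (n - z + 1), (if (k : ℝ) ≤ v + K - z then binomPMF (n - z) p k else 0)
      + ∑ k ∈ Finset.range (n - z + 1),
        (if v < ((z + k - min (z + k) K : ℕ) : ℝ) then binomPMF (n - z) p k else 0) := by
    rw [← Finset.sum_add_distrib]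
    refine Finset.sum_le_sum fun k _ => ?_
    have h0 := binomPMF_nonneg (n - z) p k hp0 hp1
    by_cases h : (k : ℝ) ≤ v + K - z
    · rw [if_pos h]
      split_ifs <;> linarith
    · rw [if_neg h, if_pos, zero_add]
      have : z + k ≤ (z + k - min (z + k) K) + K := by omega
      have : (z : ℝ) + k ≤ ((z + k - min (z + k) K : ℕ) : ℝ) + K := by exact_mod_cast this
      linarith
  rw [binomPMF_sum] at hsplit
  linarith

/-- With `α = K/n`, `0 < α < p`, `0 < β < 1`, `β < (p−α)/p` and `0 < δ < p − α/(1−β)`, let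
`(x_k)` be the mean-field sequence `x₀ = 0`, `x_{k+1} = x_k + (n − x_k)(p − δ) − nα`.
Then for every `t ≥ 1` with `x_s ≤ nβ` for all `0 ≤ s ≤ t − 1`, the error chain started at
`X₀ = 0` satisfies `P[X_t > x_t] ≥ (1 − exp(−2n(1−β)δ²))^t`. -/
theorem chain_dominates_mean_field (n K : ℕ) (hn : 0 < n) (p α β δ : ℝ)
    (hp0 : 0 < p) (hp1 : p < 1) (hKn : K ≤ n)
    (hα : α = (K : ℝ) / n) (hα0 : 0 < α) (hαp : α < p)
    (hβ0 : 0 < β) (hβ1 : β < 1) (hβ : β < (p - α) / p)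
    (hδ0 : 0 < δ) (hδ : δ < p - α / (1 - β))
    (x : ℕ → ℝ) (hx0 : x 0 = 0)
    (hrec : ∀ k : ℕ, x (k + 1) = x k + ((n : ℝ) - x k) * (p - δ) - (n : ℝ) * α)
    (t : ℕ) (ht : 1 ≤ t) (hbd : ∀ s : ℕ, s < t → x s ≤ (n : ℝ) * β) :
    (1 - Real.exp (-2 * n * (1 - β) * δ ^ 2)) ^ t ≤
      ∑ y ∈ Finset.range (n + 1),
        if x t < (y : ℝ) then iterProb n K p t 0 y else 0 := by
  have hn' : (n : ℝ) ≠ 0 := by positivity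
  have hnα : (n : ℝ) * α = K := by rw [hα]; field_simp
  have hq : 0 ≤ 1 - Real.exp (-2 * n * (1 - β) * δ ^ 2) := by
    have : Real.exp (-2 * n * (1 - β) * δ ^ 2) ≤ 1 := by
      apply Real.exp_le_one_iff.2
      have : 0 ≤ (n : ℝ) * (1 - β) * δ ^ 2 :=
        mul_nonneg (mul_nonneg (by positivity) (by linarith)) (by positivity)
      linarith
    linarith
  set q := 1 - Real.exp (-2 * n * (1 - β) * δ ^ 2) with hqdef
  have main : ∀ m s : ℕ, s + m = t → ∀ z : ℕ, z ≤ n → x s ≤ z → (m = 0 → x s < z) →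
      q ^ m ≤ ∑ y ∈ Finset.range (n + 1), if x t < (y : ℝ) then iterProb n K p m z y else 0 := by
    intro m
    induction m with
    | zero =>
      intro s hs z hz _ h
      have hs' : s = t := by omega
      subst hs'
      have h' := h rfl
      have hnn : ∀ y ∈ Finset.range (n + 1),
          0 ≤ if x s < (y : ℝ) then iterProb n K p 0 z y else 0 := by
        intro y _
        split_ifs
        · exact iterProb_nonneg n K p hp0 hp1 0 z y
        · exact le_rfl
      have := Finset.single_le_sum hnn (Finset.mem_range.2 (Nat.lt_succ_of_le hz))
      simpa [h', iterProb] using this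
    | succ m ih =>
      intro s hs z hz hxz _
      have hstep := step_bound n K p β δ (x s) (x (s + 1)) hp0 hp1 hδ0 (hbd s (by omega))
        (by rw [hrec, hnα]) z hz hxz
      rw [← hqdef] at hstep
      have hG : ∑ y ∈ Finset.range (n + 1), (if x t < (y : ℝ) then iterProb n K p (m + 1) z y else 0)
          = ∑ w ∈ Finset.range (n + 1), stepProb n K p z w *
            ∑ y ∈ Finset.range (n + 1), if x t < (y : ℝ) then iterProb n K p m w y else 0 := by
        simp only [Finset.mul_sum, iterProb]
        rw [Finset.sum_comm]
        refine Finset.sum_congr rfl fun y _ => ?_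
        split_ifs <;> simp
      rw [hG, pow_succ']
      refine (mul_le_mul_of_nonneg_right hstep (pow_nonneg hq m)).trans ?_
      rw [Finset.sum_mul]
      refine Finset.sum_le_sum fun w hw => ?_
      have hs0 := stepProb_nonneg n K p z w hp0 hp1
      split_ifs with h
      · refine mul_le_mul_of_nonneg_left ?_ hs0
        exact ih (s + 1) (by omega) w (by simp at hw; omega) h.le (fun _ => h)
      · rw [zero_mul]
        refine mul_nonneg hs0 (Finset.sum_nonneg fun y _ => ?_)
        split_ifs
        · exact iterProb_nonneg n K p hp0 hp1 m w y
        · exact le_rfl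
  exact main t 0 (by omega) 0 (by omega) (by simp [hx0]) (by omega)
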